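/- arXiv:1708.04832 — 2 statements merged into one kernel-verified Lean document; each statement's English description precedes it below -/
import Mathlib

section
/- Let d be any compatible metric on X^Γ and compute F and F* with respect to f = σ_φ. Suppose that to every x = (x_α) ∈ X^Γ a point y^x = (y^x_α) ∈ X^Γ is assigned such that {α ∈ Γ : x_α ≠ y^x_α} is a finite set consisting of non-quasi-periodic points of φ. Then for all u, v ∈ X^Γ and every D ⊆ X^Γ: (1) (for all t > 0, F*_{uv}(t) = 1) if and only if (for all t > 0, F*_{y^u y^v}(t) = 1); (2) (there exists t > 0 with F_{xz}(t) = 0 for all distinct x,z ∈ D) if and only if (there exists t > 0 with F_{y^x y^z}(t) = 0 for all distinct x,z ∈ D); (3) (there exists t > 0 with F_{xz}(t) < 1 for all distinct x,z ∈ D) if and only if (there exists t > 0 with F_{y^x y^z}(t) < 1 for all distinct x,z ∈ D). -/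
open Filter Topology

/-- `d : Y → Y → ℝ` is a metric on the topological space `Y` compatible with
(i.e. inducing) its topology. -/
def IsCompatibleMetric (Y : Type*) [t : TopologicalSpace Y] (d : Y → Y → ℝ) : Prop :=
  ∃ m : MetricSpace Y, m.toUniformSpace.toTopologicalSpace = t ∧ ∀ a b, m.dist a b = d a b

/-- The generalized shift `σ_φ : X^Γ → X^Γ`, `σ_φ((x_α)_α) = (x_{φ(α)})_α`. -/
def genShift {X Γ : Type*} (φ : Γ → Γ) (x : Γ → X) : Γ → X := fun α => x (φ α)

/-- `θ` is a quasi-periodic point of `φ` iff its forward orbit `{φ^n(θ) : n ≥ 0}` is finite. -/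
def QuasiPeriodic {Γ : Type*} (φ : Γ → Γ) (θ : Γ) : Prop :=
  (Set.range fun n : ℕ => φ^[n] θ).Finite

/-- `θ` is a periodic point of `φ` iff `φ^n(θ) = θ` for some `n ≥ 1`. -/
def PeriodicPt {Γ : Type*} (φ : Γ → Γ) (θ : Γ) : Prop := ∃ n ≥ 1, φ^[n] θ = θ

/-- `ξ(x,y,t,n) = #{i ∈ {0,…,n−1} : d(f^i(x), f^i(y)) < t}`. -/
noncomputable def xiCount {Y : Type*} (d : Y → Y → ℝ) (f : Y → Y) (x y : Y) (t : ℝ) (n : ℕ) :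
    ℕ :=
  {i : ℕ | i < n ∧ d (f^[i] x) (f^[i] y) < t}.ncard

/-- `F_{xy}(t) = liminf_n ξ(x,y,t,n)/n`. -/
noncomputable def Fdist {Y : Type*} (d : Y → Y → ℝ) (f : Y → Y) (x y : Y) (t : ℝ) : ℝ :=
  liminf (fun n : ℕ => (xiCount d f x y t n : ℝ) / n) atTop

/-- `F*_{xy}(t) = limsup_n ξ(x,y,t,n)/n`. -/
noncomputable def FdistStar {Y : Type*} (d : Y → Y → ℝ) (f : Y → Y) (x y : Y) (t : ℝ) : ℝ :=
  limsup (fun n : ℕ => (xiCount d f x y t n : ℝ) / n) atTop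

/-- `ζ(x,y,γ_D,n) = #{i ∈ {0,…,n−1} : (f^i(x), f^i(y)) ∈ γ_D}` where
`γ_D = {(u,v) : u_α = v_α for all α ∈ D}`. -/
noncomputable def zetaCount {X Γ : Type*} (f : (Γ → X) → (Γ → X)) (x y : Γ → X) (D : Set Γ)
    (n : ℕ) : ℕ :=
  {i : ℕ | i < n ∧ ∀ α ∈ D, f^[i] x α = f^[i] y α}.ncard

/-- `G_{xy}(γ_D) = liminf_n ζ(x,y,γ_D,n)/n`. -/
noncomputable def Gdist {X Γ : Type*} (f : (Γ → X) → (Γ → X)) (x y : Γ → X) (D : Set Γ) : ℝ :=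
  liminf (fun n : ℕ => (zetaCount f x y D n : ℝ) / n) atTop

/-- `G*_{xy}(γ_D) = limsup_n ζ(x,y,γ_D,n)/n`. -/
noncomputable def GdistStar {X Γ : Type*} (f : (Γ → X) → (Γ → X)) (x y : Γ → X) (D : Set Γ) :
    ℝ :=
  limsup (fun n : ℕ => (zetaCount f x y D n : ℝ) / n) atTop

/-- `x, y` are distributionally scrambled of type 1 (w.r.t. the metric `d` and the map `f`). -/
def DistScrambled1 {Y : Type*} (d : Y → Y → ℝ) (f : Y → Y) (x y : Y) : Prop :=
  (∃ s > 0, Fdist d f x y s = 0) ∧ ∀ s > 0, FdistStar d f x y s = 1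

/-- `x, y` are distributionally scrambled of type 2. -/
def DistScrambled2 {Y : Type*} (d : Y → Y → ℝ) (f : Y → Y) (x y : Y) : Prop :=
  (∃ s > 0, Fdist d f x y s < 1) ∧ ∀ s > 0, FdistStar d f x y s = 1

/-- `x, y` are distributionally scrambled of type 3. -/
def DistScrambled3 {Y : Type*} (d : Y → Y → ℝ) (f : Y → Y) (x y : Y) : Prop :=
  ∃ a b : ℝ, 0 < a ∧ a < b ∧ ∀ s ∈ Set.Icc a b, Fdist d f x y s < FdistStar d f x y s

/-- `A` is a distributionally scrambled set of type 1: it has at least two elements and all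
pairs of distinct points of `A` are distributionally scrambled of type 1. -/
def DistScrambledSet1 {Y : Type*} (d : Y → Y → ℝ) (f : Y → Y) (A : Set Y) : Prop :=
  A.Nontrivial ∧ ∀ x ∈ A, ∀ y ∈ A, x ≠ y → DistScrambled1 d f x y

/-- `A` is a distributionally scrambled set of type 2. -/
def DistScrambledSet2 {Y : Type*} (d : Y → Y → ℝ) (f : Y → Y) (A : Set Y) : Prop :=
  A.Nontrivial ∧ ∀ x ∈ A, ∀ y ∈ A, x ≠ y → DistScrambled2 d f x y

/-- `A` is a distributionally scrambled set of type 3. -/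
def DistScrambledSet3 {Y : Type*} (d : Y → Y → ℝ) (f : Y → Y) (A : Set Y) : Prop :=
  A.Nontrivial ∧ ∀ x ∈ A, ∀ y ∈ A, x ≠ y → DistScrambled3 d f x y

/-- `(Y,f)` is uniform distributionally chaotic: there is an uncountable distributionally
scrambled set `A` of type 1 and a single `ε > 0` with `F_{xy}(ε) = 0` for distinct `x,y ∈ A`. -/
def UniformDC {Y : Type*} (d : Y → Y → ℝ) (f : Y → Y) : Prop :=
  ∃ A : Set Y, ¬ A.Countable ∧ DistScrambledSet1 d f A ∧
    ∃ ε > 0, ∀ x ∈ A, ∀ y ∈ A, x ≠ y → Fdist d f x y ε = 0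

/-- `a` is a transitive point of `f`: its forward orbit is dense. -/
def TransitivePoint {Y : Type*} [TopologicalSpace Y] (f : Y → Y) (a : Y) : Prop :=
  Dense (Set.range fun n : ℕ => f^[n] a)

/-- `(Y,f)` is dense distributionally chaotic: uniform distributional chaos witnessed by a
dense set. -/
def DenseDC {Y : Type*} [TopologicalSpace Y] (d : Y → Y → ℝ) (f : Y → Y) : Prop :=
  ∃ A : Set Y, ¬ A.Countable ∧ Dense A ∧ DistScrambledSet1 d f A ∧
    ∃ ε > 0, ∀ x ∈ A, ∀ y ∈ A, x ≠ y → Fdist d f x y ε = 0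

/-- `(Y,f)` is transitive distributionally chaotic: uniform distributional chaos witnessed by a
dense set of transitive points. -/
def TransitiveDC {Y : Type*} [TopologicalSpace Y] (d : Y → Y → ℝ) (f : Y → Y) : Prop :=
  ∃ A : Set Y, ¬ A.Countable ∧ Dense A ∧ (∀ a ∈ A, TransitivePoint f a) ∧
    DistScrambledSet1 d f A ∧
    ∃ ε > 0, ∀ x ∈ A, ∀ y ∈ A, x ≠ y → Fdist d f x y ε = 0

/-- The ω-limit set of `a` under `f`: all limits of `f^[n k] a` along strictly increasing
sequences `n`. -/
def OmegaSet {Y : Type*} [TopologicalSpace Y] (f : Y → Y) (a : Y) : Set Y :=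
  {z | ∃ n : ℕ → ℕ, StrictMono n ∧ Tendsto (fun k => f^[n k] a) atTop (nhds z)}

/-- The set of periodic points of `f`. -/
def PerSet {Y : Type*} (f : Y → Y) : Set Y := {y | ∃ n ≥ 1, f^[n] y = y}

/-- `x, y` are `ω^u`-scrambled. -/
def OmegaUScrambled {Y : Type*} [TopologicalSpace Y] (f : Y → Y) (x y : Y) : Prop :=
  ¬ (OmegaSet f x \ OmegaSet f y).Countable ∧
    (OmegaSet f x ∩ OmegaSet f y).Nonempty ∧ (OmegaSet f x \ PerSet f).Nonempty

/-- `x, y` are `ω^∞`-scrambled. -/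
def OmegaInfScrambled {Y : Type*} [TopologicalSpace Y] (f : Y → Y) (x y : Y) : Prop :=
  (OmegaSet f x \ OmegaSet f y).Infinite ∧
    (OmegaSet f x ∩ OmegaSet f y).Nonempty ∧ (OmegaSet f x \ PerSet f).Nonempty

/-- `A` is an `ω^u`-scrambled set. -/
def OmegaUScrambledSet {Y : Type*} [TopologicalSpace Y] (f : Y → Y) (A : Set Y) : Prop :=
  A.Nontrivial ∧ ∀ x ∈ A, ∀ y ∈ A, x ≠ y → OmegaUScrambled f x y

/-- `A` is an `ω^∞`-scrambled set. -/
def OmegaInfScrambledSet {Y : Type*} [TopologicalSpace Y] (f : Y → Y) (A : Set Y) : Prop :=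
  A.Nontrivial ∧ ∀ x ∈ A, ∀ y ∈ A, x ≠ y → OmegaInfScrambled f x y

theorem genShift_iterate_apply {X Γ : Type*} (φ : Γ → Γ) (n : ℕ) (x : Γ → X) (α : Γ) :
    (genShift φ)^[n] x α = x (φ^[n] α) := by
  induction n generalizing x with
  | zero => rfl
  | succ n ih =>
    rw [Function.iterate_succ_apply, ih, Function.iterate_succ_apply']
    rfl

theorem quasiPeriodic_of_iterate_eq {Γ : Type*} {φ : Γ → Γ} {θ : Γ} {k : ℕ} (hk : 0 < k)
    (h : φ^[k] θ = θ) : QuasiPeriodic φ θ := by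
  refine ((Set.finite_lt_nat k).image fun n => φ^[n] θ).subset ?_
  rintro _ ⟨n, rfl⟩
  exact ⟨n % k, Nat.mod_lt _ hk, Function.IsPeriodicPt.iterate_mod_apply (x := θ) h n⟩

/-- An orbit meets a non-quasi-periodic point at most once. -/
theorem subsingleton_iterate_eq {Γ : Type*} {φ : Γ → Γ} {θ : Γ} (hθ : ¬ QuasiPeriodic φ θ)
    (α : Γ) : {n : ℕ | φ^[n] α = θ}.Subsingleton := by
  have key : ∀ m n : ℕ, φ^[m] α = θ → φ^[n] α = θ → ¬ m < n := by
    intro m n hm hn hlt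
    refine hθ (quasiPeriodic_of_iterate_eq (Nat.sub_pos_of_lt hlt) ?_)
    rw [← hm, ← Function.iterate_add_apply, Nat.sub_add_cancel hlt.le, hn, hm]
  intro m hm n hn
  exact le_antisymm (not_lt.1 (key n m hn hm)) (not_lt.1 (key m n hm hn))

theorem eventually_genShift_iterate_eq {X Γ : Type*} {φ : Γ → Γ} {x y : Γ → X}
    (hfin : {α : Γ | x α ≠ y α}.Finite) (hqp : ∀ α : Γ, x α ≠ y α → ¬ QuasiPeriodic φ α)
    (α : Γ) : ∀ᶠ n in atTop, (genShift φ)^[n] x α = (genShift φ)^[n] y α := by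
  have hset : {n : ℕ | x (φ^[n] α) ≠ y (φ^[n] α)}.Finite := by
    refine (hfin.biUnion fun θ hθ => (subsingleton_iterate_eq (hqp θ hθ) α).finite).subset ?_
    intro n hn
    exact Set.mem_biUnion (x := φ^[n] α) hn rfl
  have h := hset.eventually_cofinite_notMem
  rw [Nat.cofinite_eq_atTop] at h
  filter_upwards [h] with n hn
  rw [genShift_iterate_apply, genShift_iterate_apply]
  exact not_not.1 hn

/-- In a compact metrizable power of a discrete space, pointwise eventual agreement of two
sequences forces their distance to tend to zero, for every compatible metric. -/
theorem IsCompatibleMetric.tendsto_zero_of_eventually_eq {X Γ : Type*} [Finite X]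
    [t : TopologicalSpace X] [DiscreteTopology X] {d : (Γ → X) → (Γ → X) → ℝ}
    (hd : IsCompatibleMetric (Γ → X) d) {a b : ℕ → Γ → X}
    (h : ∀ α, ∀ᶠ n in atTop, a n α = b n α) :
    Tendsto (fun n => d (a n) (b n)) atTop (𝓝 0) := by
  obtain ⟨m, hm, hmd⟩ := hd
  obtain rfl : t = ⊥ := DiscreteTopology.eq_bot
  let uX : UniformSpace X := ⊥
  have huni : m.toUniformSpace = Pi.uniformSpace fun _ : Γ => X :=
    unique_uniformity_of_compact hm rfl
  have hlim : Tendsto (fun n => (a n, b n)) atTop (@uniformity _ m.toUniformSpace) := by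
    rw [huni, Pi.uniformity]
    refine tendsto_iInf.2 fun α => tendsto_comap_iff.2 fun s hs => ?_
    refine mem_map.2 ?_
    filter_upwards [h α] with n hn
    simp only [Set.mem_preimage, Function.comp_apply, hn]
    exact refl_mem_uniformity hs
  simpa only [← hmd] using (tendsto_uniformity_iff_dist_tendsto_zero.1 hlim)

/-- Pairs whose orbits are asymptotic to the orbits of `x, y` have, up to a bounded error and a
slightly larger threshold, at least as many close times as `x, y`. -/
theorem exists_xiCount_le_add {Y : Type*} [TopologicalSpace Y] {d : Y → Y → ℝ}
    (hd : IsCompatibleMetric Y d) {f : Y → Y} {x y x' y' : Y}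
    (hx : Tendsto (fun n => d (f^[n] x) (f^[n] x')) atTop (𝓝 0))
    (hy : Tendsto (fun n => d (f^[n] y) (f^[n] y')) atTop (𝓝 0)) {s t : ℝ} (hst : s < t) :
    ∃ C : ℕ, ∀ n, xiCount d f x y s n ≤ xiCount d f x' y' t n + C := by
  obtain ⟨m, -, hmd⟩ := hd
  have hε : 0 < (t - s) / 2 := by linarith
  obtain ⟨N, hN⟩ := eventually_atTop.1 ((hx.eventually_lt_const hε).and (hy.eventually_lt_const hε))
  refine ⟨N, fun n => ?_⟩
  have hsub : {i : ℕ | i < n ∧ d (f^[i] x) (f^[i] y) < s} ⊆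
      {i : ℕ | i < n ∧ d (f^[i] x') (f^[i] y') < t} ∪ Set.Iio N := by
    rintro i ⟨hi, his⟩
    by_cases hiN : i < N
    · exact Or.inr hiN
    · refine Or.inl ⟨hi, ?_⟩
      obtain ⟨h1, h2⟩ := hN i (not_lt.1 hiN)
      rw [← hmd] at his h1 h2 ⊢
      have h3 := dist_triangle4 (f^[i] x') (f^[i] x) (f^[i] y) (f^[i] y')
      have h4 := dist_comm (f^[i] x') (f^[i] x)
      change dist _ _ < _ at his h1 h2 ⊢
      linarith
  calc xiCount d f x y s n
      ≤ _ := Set.ncard_le_ncard hsub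
        (((Set.finite_lt_nat n).subset fun i hi => hi.1).union (Set.finite_Iio N))
    _ ≤ _ := Set.ncard_union_le _ _
    _ = xiCount d f x' y' t n + N := by
      rw [← Nat.card_coe_set_eq (Set.Iio N)]
      simp [xiCount]

theorem xiCount_div_nonneg {Y : Type*} (d : Y → Y → ℝ) (f : Y → Y) (x y : Y) (t : ℝ) (n : ℕ) :
    0 ≤ (xiCount d f x y t n : ℝ) / n := by
  positivity

theorem xiCount_div_le_one {Y : Type*} (d : Y → Y → ℝ) (f : Y → Y) (x y : Y) (t : ℝ) (n : ℕ) :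
    (xiCount d f x y t n : ℝ) / n ≤ 1 := by
  refine div_le_one_of_le₀ ?_ n.cast_nonneg
  have h : xiCount d f x y t n ≤ (Set.Iio n).ncard :=
    Set.ncard_le_ncard (fun i hi => hi.1) (Set.finite_Iio n)
  rw [← Nat.card_coe_set_eq] at h
  simpa using h

theorem isBoundedUnder_le_xiCount_div {Y : Type*} (d : Y → Y → ℝ) (f : Y → Y) (x y : Y) (t : ℝ) :
    IsBoundedUnder (· ≤ ·) atTop fun n : ℕ => (xiCount d f x y t n : ℝ) / n :=
  isBoundedUnder_of ⟨1, xiCount_div_le_one d f x y t⟩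

theorem isBoundedUnder_ge_xiCount_div {Y : Type*} (d : Y → Y → ℝ) (f : Y → Y) (x y : Y) (t : ℝ) :
    IsBoundedUnder (· ≥ ·) atTop fun n : ℕ => (xiCount d f x y t n : ℝ) / n :=
  isBoundedUnder_of ⟨0, xiCount_div_nonneg d f x y t⟩

theorem Fdist_nonneg {Y : Type*} (d : Y → Y → ℝ) (f : Y → Y) (x y : Y) (t : ℝ) :
    0 ≤ Fdist d f x y t :=
  le_liminf_of_le (isBoundedUnder_le_xiCount_div d f x y t).isCoboundedUnder_ge
    (Eventually.of_forall (xiCount_div_nonneg d f x y t))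

theorem FdistStar_le_one {Y : Type*} (d : Y → Y → ℝ) (f : Y → Y) (x y : Y) (t : ℝ) :
    FdistStar d f x y t ≤ 1 :=
  limsup_le_of_le (isBoundedUnder_ge_xiCount_div d f x y t).isCoboundedUnder_le
    (Eventually.of_forall (xiCount_div_le_one d f x y t))

theorem eventually_xiCount_div_le_add {Y : Type*} {d : Y → Y → ℝ} {f : Y → Y} {x y x' y' : Y}
    {s t : ℝ} {C : ℕ} (h : ∀ n, xiCount d f x y s n ≤ xiCount d f x' y' t n + C) {ε : ℝ}
    (hε : 0 < ε) :
    ∀ᶠ n : ℕ in atTop, (xiCount d f x y s n : ℝ) / n ≤ (xiCount d f x' y' t n : ℝ) / n + ε := by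
  filter_upwards [(tendsto_const_div_atTop_nhds_zero_nat (C : ℝ)).eventually_lt_const hε]
    with n hn
  calc (xiCount d f x y s n : ℝ) / n ≤ ((xiCount d f x' y' t n : ℝ) + C) / n := by
        gcongr
        exact_mod_cast h n
    _ = (xiCount d f x' y' t n : ℝ) / n + C / n := add_div _ _ _
    _ ≤ _ := by gcongr

theorem Fdist_le_of_xiCount_le_add {Y : Type*} {d : Y → Y → ℝ} {f : Y → Y} {x y x' y' : Y}
    {s t : ℝ} {C : ℕ} (h : ∀ n, xiCount d f x y s n ≤ xiCount d f x' y' t n + C) :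
    Fdist d f x y s ≤ Fdist d f x' y' t := by
  refine le_of_forall_pos_le_add fun ε hε => sub_le_iff_le_add.1 ?_
  refine le_liminf_of_le (isBoundedUnder_le_xiCount_div d f x' y' t).isCoboundedUnder_ge ?_
  have hlt : Fdist d f x y s - ε / 2 < Fdist d f x y s := by linarith
  filter_upwards [eventually_xiCount_div_le_add h (half_pos hε),
    eventually_lt_of_lt_liminf hlt (isBoundedUnder_ge_xiCount_div d f x y s)] with n h1 h2
  linarith

theorem FdistStar_le_of_xiCount_le_add {Y : Type*} {d : Y → Y → ℝ} {f : Y → Y} {x y x' y' : Y}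
    {s t : ℝ} {C : ℕ} (h : ∀ n, xiCount d f x y s n ≤ xiCount d f x' y' t n + C) :
    FdistStar d f x y s ≤ FdistStar d f x' y' t := by
  refine le_of_forall_pos_le_add fun ε hε => ?_
  refine limsup_le_of_le (isBoundedUnder_ge_xiCount_div d f x y s).isCoboundedUnder_le ?_
  have hlt : FdistStar d f x' y' t < FdistStar d f x' y' t + ε / 2 := by linarith
  filter_upwards [eventually_xiCount_div_le_add h (half_pos hε),
    eventually_lt_of_limsup_lt hlt (isBoundedUnder_le_xiCount_div d f x' y' t)] with n h1 h2
  linarith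

variable {X : Type*} [Fintype X] [TopologicalSpace X] [DiscreteTopology X] [Nontrivial X]
variable {Γ : Type*} [Countable Γ] [Nonempty Γ]
/-- with `F`, `F*` computed for `f = σ_φ` and a compatible metric `d`, suppose
each `x ∈ X^Γ` is assigned `y^x ∈ X^Γ` with `{α : x_α ≠ y^x_α}` a finite set of
non-quasi-periodic points of `φ`. Then the three stated equivalences hold. -/
theorem F_conditions_iff_of_finite_diff_assignment
    (φ : Γ → Γ)
    (d : (Γ → X) → (Γ → X) → ℝ) (hd : IsCompatibleMetric (Γ → X) d)
    (yy : (Γ → X) → (Γ → X))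
    (hyy : ∀ x : Γ → X,
      {α : Γ | x α ≠ yy x α}.Finite ∧ ∀ α : Γ, x α ≠ yy x α → ¬ QuasiPeriodic φ α)
    (u v : Γ → X) (D : Set (Γ → X)) :
    ((∀ t > (0 : ℝ), FdistStar d (genShift (X := X) φ) u v t = 1) ↔
        (∀ t > (0 : ℝ), FdistStar d (genShift (X := X) φ) (yy u) (yy v) t = 1)) ∧
    ((∃ t > (0 : ℝ), ∀ x ∈ D, ∀ z ∈ D, x ≠ z → Fdist d (genShift (X := X) φ) x z t = 0) ↔
        (∃ t > (0 : ℝ), ∀ x ∈ D, ∀ z ∈ D, x ≠ z →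
          Fdist d (genShift (X := X) φ) (yy x) (yy z) t = 0)) ∧
    ((∃ t > (0 : ℝ), ∀ x ∈ D, ∀ z ∈ D, x ≠ z → Fdist d (genShift (X := X) φ) x z t < 1) ↔
        (∃ t > (0 : ℝ), ∀ x ∈ D, ∀ z ∈ D, x ≠ z →
          Fdist d (genShift (X := X) φ) (yy x) (yy z) t < 1)) := by
  have hasymp : ∀ x, Tendsto
      (fun n => d ((genShift (X := X) φ)^[n] x) ((genShift (X := X) φ)^[n] (yy x))) atTop (𝓝 0) :=
    fun x => hd.tendsto_zero_of_eventually_eq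
      (eventually_genShift_iterate_eq (hyy x).1 (hyy x).2)
  have hasymp' : ∀ x, Tendsto
      (fun n => d ((genShift (X := X) φ)^[n] (yy x)) ((genShift (X := X) φ)^[n] x)) atTop (𝓝 0) :=
    fun x => hd.tendsto_zero_of_eventually_eq fun α =>
      (eventually_genShift_iterate_eq (hyy x).1 (hyy x).2 α).mono fun _ h => h.symm
  have hto : ∀ (x z : Γ → X) {t : ℝ}, 0 < t → ∃ C : ℕ, ∀ n,
      xiCount d (genShift φ) x z (t / 2) n ≤ xiCount d (genShift φ) (yy x) (yy z) t n + C :=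
    fun x z _ ht => exists_xiCount_le_add hd (hasymp x) (hasymp z) (half_lt_self ht)
  have hfrom : ∀ (x z : Γ → X) {t : ℝ}, 0 < t → ∃ C : ℕ, ∀ n,
      xiCount d (genShift φ) (yy x) (yy z) (t / 2) n ≤ xiCount d (genShift φ) x z t n + C :=
    fun x z _ ht => exists_xiCount_le_add hd (hasymp' x) (hasymp' z) (half_lt_self ht)
  refine ⟨⟨fun h t ht => ?_, fun h t ht => ?_⟩, ⟨?_, ?_⟩, ⟨?_, ?_⟩⟩
  · obtain ⟨C, hC⟩ := hto u v ht
    exact le_antisymm (FdistStar_le_one _ _ _ _ _)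
      ((h _ (half_pos ht)).symm.trans_le (FdistStar_le_of_xiCount_le_add hC))
  · obtain ⟨C, hC⟩ := hfrom u v ht
    exact le_antisymm (FdistStar_le_one _ _ _ _ _)
      ((h _ (half_pos ht)).symm.trans_le (FdistStar_le_of_xiCount_le_add hC))
  · rintro ⟨t, ht, h⟩
    refine ⟨t / 2, half_pos ht, fun x hx z hz hxz => ?_⟩
    obtain ⟨C, hC⟩ := hfrom x z ht
    exact le_antisymm ((Fdist_le_of_xiCount_le_add hC).trans_eq (h x hx z hz hxz))
      (Fdist_nonneg _ _ _ _ _)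
  · rintro ⟨t, ht, h⟩
    refine ⟨t / 2, half_pos ht, fun x hx z hz hxz => ?_⟩
    obtain ⟨C, hC⟩ := hto x z ht
    exact le_antisymm ((Fdist_le_of_xiCount_le_add hC).trans_eq (h x hx z hz hxz))
      (Fdist_nonneg _ _ _ _ _)
  · rintro ⟨t, ht, h⟩
    refine ⟨t / 2, half_pos ht, fun x hx z hz hxz => ?_⟩
    obtain ⟨C, hC⟩ := hfrom x z ht
    exact (Fdist_le_of_xiCount_le_add hC).trans_lt (h x hx z hz hxz)
  · rintro ⟨t, ht, h⟩
    refine ⟨t / 2, half_pos ht, fun x hx z hz hxz => ?_⟩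
    obtain ⟨C, hC⟩ := hto x z ht
    exact (Fdist_le_of_xiCount_le_add hC).trans_lt (h x hx z hz hxz)
end

section
/- For any compatible metric d on X^Γ, the generalized shift dynamical system (X^Γ, σ_φ) is dense distributional chaotic if and only if φ : Γ → Γ has no periodic point. -/
open Filter Topology

/-! ### Compatible metrics -/

section CompatibleMetric

variable {Y : Type*} [TopologicalSpace Y] {d : Y → Y → ℝ}

theorem IsCompatibleMetric.continuous (hd : IsCompatibleMetric Y d) :
    Continuous fun p : Y × Y => d p.1 p.2 := by
  obtain ⟨m, rfl, h⟩ := hd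
  simp only [← h]
  exact continuous_dist

theorem IsCompatibleMetric.pos (hd : IsCompatibleMetric Y d) {a b : Y} (hab : a ≠ b) :
    0 < d a b := by
  obtain ⟨m, -, h⟩ := hd
  rw [← h]
  exact dist_pos.2 hab

theorem IsCompatibleMetric.eq_zero (hd : IsCompatibleMetric Y d) (a : Y) : d a a = 0 := by
  obtain ⟨m, -, h⟩ := hd
  rw [← h]
  exact dist_self a

variable {X Γ : Type*} [TopologicalSpace X] [DiscreteTopology X]

/-- The set of pairs which agree at a given coordinate is clopen. -/
theorem isClopen_agree (α : Γ) :
    IsClopen {p : (Γ → X) × (Γ → X) | p.1 α = p.2 α} := by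
  have hc : Continuous fun p : (Γ → X) × (Γ → X) => (p.1 α, p.2 α) := by fun_prop
  exact (isClopen_discrete {q : X × X | q.1 = q.2}).preimage hc

/-- Points which are close enough agree at a given coordinate. -/
theorem IsCompatibleMetric.exists_pos_agree [Finite X] {d : (Γ → X) → (Γ → X) → ℝ}
    (hd : IsCompatibleMetric (Γ → X) d) (α : Γ) :
    ∃ s > 0, ∀ u v, d u v < s → u α = v α := by
  have hK : IsCompact {p : (Γ → X) × (Γ → X) | p.1 α = p.2 α}ᶜ :=
    (isClopen_agree α).compl.isClosed.isCompact
  rcases Set.eq_empty_or_nonempty {p : (Γ → X) × (Γ → X) | p.1 α = p.2 α}ᶜ with h | h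
  · refine ⟨1, one_pos, fun u v _ => ?_⟩
    by_contra huv
    exact (Set.ext_iff.1 h (u, v)).1 huv
  · obtain ⟨⟨a, b⟩, hab, hmin⟩ := hK.exists_isMinOn h hd.continuous.continuousOn
    refine ⟨d a b, hd.pos fun e => hab (congrFun e α), fun u v huv => ?_⟩
    by_contra hne
    exact absurd huv (not_lt.2 (hmin (a := (u, v)) hne))

/-- Points which agree at finitely many suitable coordinates are close. -/
theorem IsCompatibleMetric.exists_finset_lt [Finite X] {d : (Γ → X) → (Γ → X) → ℝ}
    (hd : IsCompatibleMetric (Γ → X) d) {s : ℝ} (hs : 0 < s) :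
    ∃ F : Finset Γ, ∀ u v, (∀ α ∈ F, u α = v α) → d u v < s := by
  have hK : IsCompact {p : (Γ → X) × (Γ → X) | s ≤ d p.1 p.2} :=
    (isClosed_le continuous_const hd.continuous).isCompact
  obtain ⟨F, hF⟩ := hK.elim_finite_subfamily_closed
    (fun α => {p : (Γ → X) × (Γ → X) | p.1 α = p.2 α}) (fun α => (isClopen_agree α).isClosed) (by
      rw [Set.eq_empty_iff_forall_notMem]
      rintro ⟨u, v⟩ ⟨h1, h2⟩
      have huv : u = v := funext fun α => Set.mem_iInter.1 h2 α
      rw [Set.mem_ofPred_eq, huv, hd.eq_zero] at h1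
      exact absurd hs (not_lt.2 h1))
  refine ⟨F, fun u v h => ?_⟩
  by_contra hlt
  have hmem := (Set.eq_empty_iff_forall_notMem.1 hF) (u, v)
  exact hmem ⟨not_lt.1 hlt, Set.mem_iInter₂.2 h⟩

end CompatibleMetric

/-! ### Densities of sets of times -/

theorem finite_setOf_lt_and (P : ℕ → Prop) (n : ℕ) : {i : ℕ | i < n ∧ P i}.Finite :=
  (Set.finite_lt_nat n).subset fun _ h => h.1

theorem ncard_lt_and_le (P : ℕ → Prop) (n : ℕ) : {i : ℕ | i < n ∧ P i}.ncard ≤ n := by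
  calc _ ≤ (↑(Finset.range n) : Set ℕ).ncard :=
        Set.ncard_le_ncard (fun i h => by simpa using h.1) (Finset.finite_toSet _)
    _ = n := by rw [Set.ncard_coe_finset, Finset.card_range]

theorem ncard_lt_and_add_not (P : ℕ → Prop) (n : ℕ) :
    {i : ℕ | i < n ∧ P i}.ncard + {i : ℕ | i < n ∧ ¬ P i}.ncard = n := by
  rw [← Set.ncard_union_eq _ (finite_setOf_lt_and _ _) (finite_setOf_lt_and _ _)]
  · have : {i : ℕ | i < n ∧ P i} ∪ {i : ℕ | i < n ∧ ¬ P i} = ↑(Finset.range n) := by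
      ext i
      simp only [Set.mem_union, Set.mem_ofPred_eq, Finset.coe_range, Set.mem_Iio]
      tauto
    rw [this, Set.ncard_coe_finset, Finset.card_range]
  · exact Set.disjoint_left.2 fun i h1 h2 => h2.2 h1.2

theorem ncard_div_nonneg (P : ℕ → Prop) (n : ℕ) :
    (0 : ℝ) ≤ ({i : ℕ | i < n ∧ P i}.ncard : ℝ) / n := by positivity

theorem ncard_div_le_one (P : ℕ → Prop) (n : ℕ) :
    ({i : ℕ | i < n ∧ P i}.ncard : ℝ) / n ≤ 1 :=
  div_le_one_of_le₀ (by exact_mod_cast ncard_lt_and_le P n) n.cast_nonneg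

theorem isBoundedUnder_le_ncard_div (P : ℕ → Prop) :
    IsBoundedUnder (· ≤ ·) atTop fun n : ℕ => ({i : ℕ | i < n ∧ P i}.ncard : ℝ) / n :=
  isBoundedUnder_of ⟨1, ncard_div_le_one P⟩

theorem isBoundedUnder_ge_ncard_div (P : ℕ → Prop) :
    IsBoundedUnder (· ≥ ·) atTop fun n : ℕ => ({i : ℕ | i < n ∧ P i}.ncard : ℝ) / n :=
  isBoundedUnder_of ⟨0, ncard_div_nonneg P⟩

theorem liminf_ncard_div_eq_zero {P : ℕ → Prop}
    (h : ∀ δ : ℝ, 0 < δ → ∃ᶠ n : ℕ in atTop, ({i : ℕ | i < n ∧ P i}.ncard : ℝ) ≤ δ * n) :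
    liminf (fun n : ℕ => ({i : ℕ | i < n ∧ P i}.ncard : ℝ) / n) atTop = 0 := by
  apply le_antisymm
  · refine le_of_forall_pos_le_add fun δ hδ => ?_
    rw [zero_add]
    refine liminf_le_of_frequently_le ((h δ hδ).mono fun n hn => ?_)
      (isBoundedUnder_ge_ncard_div P)
    exact div_le_of_le_mul₀ n.cast_nonneg hδ.le hn
  · exact le_liminf_of_le (isBoundedUnder_le_ncard_div P).isCoboundedUnder_ge
      (Eventually.of_forall (ncard_div_nonneg P))

theorem limsup_ncard_div_eq_one {P : ℕ → Prop}
    (h : ∀ δ : ℝ, 0 < δ → ∃ᶠ n : ℕ in atTop, ({i : ℕ | i < n ∧ ¬ P i}.ncard : ℝ) ≤ δ * n) :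
    limsup (fun n : ℕ => ({i : ℕ | i < n ∧ P i}.ncard : ℝ) / n) atTop = 1 := by
  apply le_antisymm
  · exact limsup_le_of_le (isBoundedUnder_ge_ncard_div P).isCoboundedUnder_le
      (Eventually.of_forall (ncard_div_le_one P))
  · refine le_of_forall_pos_le_add fun δ hδ => ?_
    rw [← sub_le_iff_le_add]
    refine le_limsup_of_frequently_le
      (((h δ hδ).and_eventually (eventually_gt_atTop 0)).mono fun n hn => ?_)
      (isBoundedUnder_le_ncard_div P)
    have hn0 : (0 : ℝ) < n := by exact_mod_cast hn.2
    have hsum : ({i : ℕ | i < n ∧ P i}.ncard : ℝ) + ({i : ℕ | i < n ∧ ¬ P i}.ncard : ℝ) = n := by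
      exact_mod_cast ncard_lt_and_add_not P n
    rw [le_div_iff₀ hn0]
    linarith [hn.1]

/-- A set of times which misses all multiples of `p ≥ 1` has upper density less than one. -/
theorem limsup_ncard_div_lt_one {P : ℕ → Prop} {p : ℕ} (hp : 1 ≤ p) (h : ∀ j, ¬ P (j * p)) :
    limsup (fun n : ℕ => ({i : ℕ | i < n ∧ P i}.ncard : ℝ) / n) atTop < 1 := by
  have hp0 : (0 : ℝ) < p := by exact_mod_cast hp
  refine lt_of_le_of_lt (b := 1 - 1 / (2 * p : ℝ))
    (limsup_le_of_le (isBoundedUnder_ge_ncard_div P).isCoboundedUnder_le ?_)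
    (sub_lt_self _ (by positivity))
  filter_upwards [eventually_ge_atTop (2 * p)] with n hn
  have hn0 : (0 : ℝ) < n := by exact_mod_cast (by omega : 0 < n)
  have hinj : Function.Injective (· * p) := mul_left_injective₀ (by omega)
  have hle : n / p ≤ {i : ℕ | i < n ∧ ¬ P i}.ncard := by
    calc n / p = (↑((Finset.range (n / p)).image (· * p)) : Set ℕ).ncard := by
          rw [Set.ncard_coe_finset, Finset.card_image_of_injective _ hinj, Finset.card_range]
      _ ≤ _ := by
          refine Set.ncard_le_ncard (fun i hi => ?_) (finite_setOf_lt_and _ _)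
          obtain ⟨j, hj, rfl⟩ := Finset.mem_image.1 (Finset.mem_coe.1 hi)
          have hj' : j * p < n / p * p :=
            Nat.mul_lt_mul_of_pos_right (Finset.mem_range.1 hj) (by omega)
          exact ⟨hj'.trans_le (Nat.div_mul_le_self n p), h j⟩
  have hsum : ({i : ℕ | i < n ∧ P i}.ncard : ℝ) + ({i : ℕ | i < n ∧ ¬ P i}.ncard : ℝ) = n := by
    exact_mod_cast ncard_lt_and_add_not P n
  have hle' : ((n / p : ℕ) : ℝ) ≤ {i : ℕ | i < n ∧ ¬ P i}.ncard := by exact_mod_cast hle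
  have hfl : (n : ℝ) ≤ 2 * p * (n / p : ℕ) := by
    have h1 := Nat.div_add_mod n p
    have h2 := Nat.mod_lt n (by omega : p > 0)
    have h3 : n ≤ 2 * p * (n / p) := by
      have : 2 * p * (n / p) = p * (n / p) + p * (n / p) := by ring
      omega
    exact_mod_cast h3
  rw [div_le_iff₀ hn0]
  have hdiv : 1 / (2 * p : ℝ) * n ≤ (n / p : ℕ) := by
    rw [one_div_mul_eq_div, div_le_iff₀ (by positivity)]
    linarith
  linarith

/-- A set of times which, up to a margin `c`, misses infinitely many of the intervals
`[2 ^ 2 ^ k, 2 ^ 2 ^ (k + 1))` has arbitrarily small relative frequency infinitely often. -/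
theorem frequently_ncard_le_of_frequently_block {P : ℕ → Prop} {c : ℕ}
    (h : ∃ᶠ k : ℕ in atTop, ∀ i, 2 ^ 2 ^ k + c ≤ i → i + c < 2 ^ 2 ^ (k + 1) → ¬ P i)
    (δ : ℝ) (hδ : 0 < δ) :
    ∃ᶠ n : ℕ in atTop, ({i : ℕ | i < n ∧ P i}.ncard : ℝ) ≤ δ * n := by
  rw [frequently_atTop] at h ⊢
  intro n₀
  obtain ⟨k₀, hk₀⟩ := exists_nat_ge ((1 + 2 * c) / δ)
  obtain ⟨k, hk, hP⟩ := h (max n₀ k₀)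
  have hpow : ∀ k : ℕ, k < 2 ^ 2 ^ k := fun k => k.lt_two_pow_self.trans (2 ^ k).lt_two_pow_self
  have hsq : (2 : ℕ) ^ 2 ^ (k + 1) = 2 ^ 2 ^ k * 2 ^ 2 ^ k := by
    rw [← pow_add, pow_succ, mul_two]
  refine ⟨2 ^ 2 ^ (k + 1), ?_, ?_⟩
  · have := hpow (k + 1)
    have := le_max_left n₀ k₀
    omega
  have hcard : {i : ℕ | i < 2 ^ 2 ^ (k + 1) ∧ P i}.ncard ≤ 2 ^ 2 ^ k + 2 * c := by
    calc _ ≤ (↑(Finset.range (2 ^ 2 ^ k + c) ∪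
            Finset.Ico (2 ^ 2 ^ (k + 1) - c) (2 ^ 2 ^ (k + 1))) : Set ℕ).ncard := by
          refine Set.ncard_le_ncard (fun i hi => ?_) (Finset.finite_toSet _)
          simp only [Finset.coe_union, Set.mem_union, Finset.mem_coe, Finset.mem_range,
            Finset.mem_Ico]
          by_contra hcon
          exact hP i (by omega) (by have := hi.1; omega) hi.2
      _ ≤ _ := by
          rw [Set.ncard_coe_finset]
          refine (Finset.card_union_le _ _).trans ?_
          rw [Finset.card_range, Nat.card_Ico]
          omega
  have hcard' : ({i : ℕ | i < 2 ^ 2 ^ (k + 1) ∧ P i}.ncard : ℝ) ≤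
      ((2 ^ 2 ^ k : ℕ) : ℝ) + 2 * c := by exact_mod_cast hcard
  have hM : (1 + 2 * c) / δ ≤ ((2 ^ 2 ^ k : ℕ) : ℝ) := by
    refine hk₀.trans (Nat.cast_le.2 ?_)
    exact ((le_max_right n₀ k₀).trans hk).trans (hpow k).le
  have hM1 : (1 : ℝ) ≤ ((2 ^ 2 ^ k : ℕ) : ℝ) := by exact_mod_cast Nat.one_le_two_pow
  rw [hsq] at hcard' ⊢
  rw [Nat.cast_mul]
  rw [div_le_iff₀ hδ] at hM
  generalize ((2 ^ 2 ^ k : ℕ) : ℝ) = M at *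
  have hc : (0 : ℝ) ≤ c := c.cast_nonneg
  nlinarith

/-! ### The dynamics of `φ` -/

section Level

variable {X Γ : Type*} {φ : Γ → Γ}

theorem genShift_iterate (φ : Γ → Γ) (i : ℕ) (x : Γ → X) (α : Γ) :
    (genShift φ)^[i] x α = x (φ^[i] α) := by
  induction i generalizing α with
  | zero => rfl
  | succ i ih => rw [Function.iterate_succ_apply', genShift, ih, Function.iterate_succ_apply]

theorem iterate_injective_of_no_periodicPt (h : ∀ θ, ¬ PeriodicPt φ θ) (α : Γ) :
    Function.Injective fun n : ℕ => φ^[n] α := by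
  refine .of_lt_imp_ne fun i j hij heq => h (φ^[i] α) ⟨j - i, by omega, ?_⟩
  rw [← Function.iterate_add_apply, Nat.sub_add_cancel hij.le]
  exact heq.symm

/-- If `φ` has no periodic point, then `φ` is semiconjugate to the translation of `ℤ`. -/
theorem exists_level (h : ∀ θ, ¬ PeriodicPt φ θ) : ∃ ℓ : Γ → ℤ, ∀ α, ℓ (φ α) = ℓ α + 1 := by
  let r : Setoid Γ :=
    { r := fun α β => ∃ n m : ℕ, φ^[n] α = φ^[m] β
      iseqv :=
        { refl := fun α => ⟨0, 0, rfl⟩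
          symm := fun ⟨n, m, e⟩ => ⟨m, n, e.symm⟩
          trans := by
            rintro α β γ ⟨n, m, e⟩ ⟨n', m', e'⟩
            refine ⟨n' + n, m + m', ?_⟩
            rw [Function.iterate_add_apply, e, ← Function.iterate_add_apply, add_comm,
              Function.iterate_add_apply, e', ← Function.iterate_add_apply] } }
  let b : Γ → Γ := fun α => (Quotient.mk r α).out
  have hb : ∀ α, ∃ n m : ℕ, φ^[n] α = φ^[m] (b α) := fun α =>
    r.symm (Quotient.exact (Quotient.out_eq (Quotient.mk r α)))
  have hbφ : ∀ α, b (φ α) = b α := fun α =>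
    congrArg Quotient.out (Quotient.sound (s := r) ⟨0, 1, rfl⟩)
  choose n m hnm using hb
  refine ⟨fun α => m α - n α, fun α => ?_⟩
  have h1 := hnm (φ α)
  rw [hbφ, ← Function.iterate_succ_apply] at h1
  have h2 : φ^[m (φ α) + n α] (b α) = φ^[n (φ α) + 1 + m α] (b α) := by
    rw [add_comm, Function.iterate_add_apply, ← h1, ← Function.iterate_add_apply, add_comm,
      Function.iterate_add_apply, hnm α, ← Function.iterate_add_apply]
  have h3 := iterate_injective_of_no_periodicPt h (b α) h2
  dsimp only
  omega

theorem level_iterate {ℓ : Γ → ℤ} (hℓ : ∀ α, ℓ (φ α) = ℓ α + 1) (i : ℕ) (α : Γ) :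
    ℓ (φ^[i] α) = ℓ α + i := by
  induction i with
  | zero => simp
  | succ i ih => rw [Function.iterate_succ_apply', hℓ, ih]; push_cast; ring

end Level

/-! ### The scrambled family -/

open Classical in
/-- The sequence coded by `t`: it equals `a` on the interval `[2 ^ 2 ^ k, 2 ^ 2 ^ (k + 1))` for
even `k`, and for `k = 2 * Nat.pair j m + 1` it equals `b` or `a` there according to `j ∈ t`. -/
noncomputable def blockWord {X : Type*} (a b : X) (t : Set ℕ) (z : ℤ) : X :=
  let k := Nat.log 2 (Nat.log 2 z.toNat)
  if k % 2 = 1 ∧ (k / 2).unpair.1 ∈ t then b else a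

open Classical in
/-- The point which agrees with `q` on `D` and follows `blockWord a b t` along the levels `ℓ`
off `D`. -/
noncomputable def blockPoint {X Γ : Type*} (a b : X) (ℓ : Γ → ℤ) (D : Finset Γ) (q : Γ → X)
    (t : Set ℕ) (α : Γ) : X :=
  if α ∈ D then q α else blockWord a b t (ℓ α)

theorem log_log_eq {k n : ℕ} (h1 : 2 ^ 2 ^ k ≤ n) (h2 : n < 2 ^ 2 ^ (k + 1)) :
    Nat.log 2 (Nat.log 2 n) = k := by
  have hn : n ≠ 0 := (lt_of_lt_of_le (by positivity) h1).ne'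
  have h3 : 2 ^ k ≤ Nat.log 2 n := Nat.le_log_of_pow_le one_lt_two h1
  exact Nat.log_eq_of_pow_le_of_lt_pow h3 (Nat.log_lt_of_lt_pow hn h2)

section BlockPoint

variable {X Γ : Type*} {φ : Γ → Γ} {ℓ : Γ → ℤ}

/-- Along the orbit of finitely many coordinates, up to a margin, a block point takes the value
prescribed by the index of the block. -/
theorem exists_margin_blockPoint (hℓ : ∀ α, ℓ (φ α) = ℓ α + 1) (a b : X) (F D : Finset Γ) :
    ∃ c : ℕ, ∀ q t, ∀ α ∈ F, ∀ k i : ℕ, 2 ^ 2 ^ k + c ≤ i → i + c < 2 ^ 2 ^ (k + 1) →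
      blockPoint a b ℓ D q t (φ^[i] α) = blockWord a b t ((2 ^ 2 ^ k : ℕ) : ℤ) := by
  refine ⟨∑ α ∈ F, (ℓ α).natAbs + ∑ α ∈ D, (ℓ α).natAbs, fun q t α hα k i h1 h2 => ?_⟩
  have hF : (ℓ α).natAbs ≤ ∑ α ∈ F, (ℓ α).natAbs :=
    Finset.single_le_sum (f := fun α => (ℓ α).natAbs) (fun _ _ => Nat.zero_le _) hα
  have hi := level_iterate hℓ i α
  have hpos : 0 < 2 ^ 2 ^ k := by positivity
  have hlt : 2 ^ 2 ^ k < 2 ^ 2 ^ (k + 1) :=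
    Nat.pow_lt_pow_right one_lt_two (Nat.pow_lt_pow_right one_lt_two k.lt_succ_self)
  have hD : φ^[i] α ∉ D := fun hmem => by
    have : (ℓ (φ^[i] α)).natAbs ≤ ∑ α ∈ D, (ℓ α).natAbs :=
      Finset.single_le_sum (f := fun α => (ℓ α).natAbs) (fun _ _ => Nat.zero_le _) hmem
    omega
  rw [blockPoint, if_neg hD, blockWord, blockWord,
    log_log_eq (k := k) (by omega) (by omega), Int.toNat_natCast, log_log_eq le_rfl hlt]

theorem blockWord_of_even (a b : X) (t : Set ℕ) {k : ℕ} (hk : k % 2 = 0) :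
    blockWord a b t ((2 ^ 2 ^ k : ℕ) : ℤ) = a := by
  have hlt : 2 ^ 2 ^ k < 2 ^ 2 ^ (k + 1) :=
    Nat.pow_lt_pow_right one_lt_two (Nat.pow_lt_pow_right one_lt_two k.lt_succ_self)
  refine if_neg fun h => ?_
  rw [Int.toNat_natCast, log_log_eq le_rfl hlt] at h
  omega

theorem frequently_blockWord_ne {a b : X} (hab : a ≠ b) {t t' : Set ℕ} (ht : t ≠ t') :
    ∃ᶠ k : ℕ in atTop,
      blockWord a b t ((2 ^ 2 ^ k : ℕ) : ℤ) ≠ blockWord a b t' ((2 ^ 2 ^ k : ℕ) : ℤ) := by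
  obtain ⟨j, hj⟩ : ∃ j, ¬ (j ∈ t ↔ j ∈ t') := by
    by_contra! h
    exact ht (Set.ext h)
  refine frequently_atTop.2 fun K => ⟨2 * Nat.pair j K + 1, ?_, ?_⟩
  · have := Nat.right_le_pair j K
    omega
  · generalize hk : 2 * Nat.pair j K + 1 = k
    have hlt : 2 ^ 2 ^ k < 2 ^ 2 ^ (k + 1) :=
      Nat.pow_lt_pow_right one_lt_two (Nat.pow_lt_pow_right one_lt_two k.lt_succ_self)
    have h1 : k % 2 = 1 := by omega
    have h2 : k / 2 = Nat.pair j K := by omega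
    simp only [blockWord, Int.toNat_natCast, log_log_eq le_rfl hlt, h1, h2, Nat.unpair_pair,
      true_and]
    by_cases ha : j ∈ t <;> by_cases hb : j ∈ t' <;> simp_all [hab.symm]

variable {d : (Γ → X) → (Γ → X) → ℝ}

theorem fdist_blockPoint_eq_zero (hℓ : ∀ α, ℓ (φ α) = ℓ α + 1) {a b : X} (hab : a ≠ b)
    {θ : Γ} {s : ℝ} (hs : ∀ u v : Γ → X, d u v < s → u θ = v θ)
    (D D' : Finset Γ) (q q' : Γ → X) {t t' : Set ℕ} (ht : t ≠ t') :
    Fdist d (genShift φ) (blockPoint a b ℓ D q t) (blockPoint a b ℓ D' q' t') s = 0 := by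
  obtain ⟨c, hc⟩ := exists_margin_blockPoint hℓ a b {θ} D
  obtain ⟨c', hc'⟩ := exists_margin_blockPoint hℓ a b {θ} D'
  refine liminf_ncard_div_eq_zero (frequently_ncard_le_of_frequently_block (c := c + c')
    ((frequently_blockWord_ne hab ht).mono fun k hk i h1 h2 hlt => hk ?_))
  have h := hs _ _ hlt
  rwa [genShift_iterate, genShift_iterate,
    hc q t θ (Finset.mem_singleton_self θ) k i (by omega) (by omega),
    hc' q' t' θ (Finset.mem_singleton_self θ) k i (by omega) (by omega)] at h

theorem fdistStar_blockPoint_eq_one [TopologicalSpace X] [DiscreteTopology X] [Finite X]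
    (hd : IsCompatibleMetric (Γ → X) d)
    (hℓ : ∀ α, ℓ (φ α) = ℓ α + 1) (a b : X) {s : ℝ} (hs : 0 < s)
    (D D' : Finset Γ) (q q' : Γ → X) (t t' : Set ℕ) :
    FdistStar d (genShift φ) (blockPoint a b ℓ D q t) (blockPoint a b ℓ D' q' t') s = 1 := by
  obtain ⟨F, hF⟩ := hd.exists_finset_lt hs
  obtain ⟨c, hc⟩ := exists_margin_blockPoint hℓ a b F D
  obtain ⟨c', hc'⟩ := exists_margin_blockPoint hℓ a b F D'
  refine limsup_ncard_div_eq_one (frequently_ncard_le_of_frequently_block (c := c + c')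
    (frequently_atTop.2 fun K => ⟨2 * K, by omega, fun i h1 h2 hlt => hlt (hF _ _ ?_)⟩))
  intro α hα
  rw [genShift_iterate, genShift_iterate, hc q t α hα (2 * K) i (by omega) (by omega),
    hc' q' t' α hα (2 * K) i (by omega) (by omega), blockWord_of_even a b t (by omega),
    blockWord_of_even a b t' (by omega)]

end BlockPoint

theorem fdist_self {Y : Type*} [TopologicalSpace Y] {d : Y → Y → ℝ}
    (hd : IsCompatibleMetric Y d) (f : Y → Y) (x : Y) {s : ℝ} (hs : 0 < s) :
    Fdist d f x x s = 1 := by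
  refine Tendsto.liminf_eq (tendsto_const_nhds.congr' ?_)
  filter_upwards [eventually_gt_atTop 0] with n hn
  have hset : {i : ℕ | i < n ∧ d (f^[i] x) (f^[i] x) < s} = ↑(Finset.range n) := by
    ext i
    simp [hd.eq_zero, hs]
  rw [xiCount, hset, Set.ncard_coe_finset, Finset.card_range, div_self (by positivity)]

section Main

variable {X Γ : Type*} [TopologicalSpace X] [DiscreteTopology X] [Finite X] [Nontrivial X]
  {φ : Γ → Γ} {d : (Γ → X) → (Γ → X) → ℝ}

theorem not_periodicPt_of_denseDC (hd : IsCompatibleMetric (Γ → X) d)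
    (h : DenseDC d (genShift (X := X) φ)) (θ : Γ) : ¬ PeriodicPt φ θ := by
  rintro ⟨p, hp, hθ⟩
  obtain ⟨A, -, hdense, hscr, -⟩ := h
  obtain ⟨a, b, hab⟩ := exists_pair_ne X
  have hopen : ∀ c : X, IsOpen {x : Γ → X | x θ = c} := fun c =>
    (isOpen_discrete {c}).preimage (continuous_apply (A := fun _ : Γ => X) θ)
  obtain ⟨x, hx, hxA⟩ := hdense.inter_open_nonempty _ (hopen a) ⟨fun _ => a, rfl⟩
  obtain ⟨y, hy, hyA⟩ := hdense.inter_open_nonempty _ (hopen b) ⟨fun _ => b, rfl⟩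
  have hne : x θ ≠ y θ := by
    rw [show x θ = a from hx, show y θ = b from hy]
    exact hab
  obtain ⟨s, hs, hagree⟩ := hd.exists_pos_agree θ
  have hone := (hscr.2 x hxA y hyA fun e => hne (congrFun e θ)).2 s hs
  refine (limsup_ncard_div_lt_one hp (P := fun i =>
    d ((genShift φ)^[i] x) ((genShift φ)^[i] y) < s) fun j hj => hne ?_).ne hone
  have hfix : φ^[j * p] θ = θ := by
    rw [mul_comm, Function.iterate_mul]
    exact Function.iterate_fixed hθ j
  simpa only [genShift_iterate, hfix] using hagree _ _ hj

theorem denseDC_of_no_periodicPt [Countable Γ] [Nonempty Γ]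
    (hd : IsCompatibleMetric (Γ → X) d) (h : ∀ θ, ¬ PeriodicPt φ θ) :
    DenseDC d (genShift (X := X) φ) := by
  obtain ⟨ℓ, hℓ⟩ := exists_level h
  obtain ⟨a, b, hab⟩ := exists_pair_ne X
  obtain ⟨θ⟩ := ‹Nonempty Γ›
  obtain ⟨ε, hε, hagree⟩ := hd.exists_pos_agree θ
  obtain ⟨g, hg⟩ := exists_surjective_nat (Finset Γ × ℕ)
  let p : Set ℕ → Finset Γ × ℕ := fun t => g (sInf t)
  have hp : Function.Surjective p := fun y => by
    obtain ⟨n, hn⟩ := hg y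
    exact ⟨{n}, by simp only [p, csInf_singleton, hn]⟩
  let x : Set ℕ → Γ → X := fun t =>
    blockPoint a b ℓ (p t).1 (TopologicalSpace.denseSeq (Γ → X) (p t).2) t
  have hF : ∀ t t', t ≠ t' → Fdist d (genShift φ) (x t) (x t') ε = 0 := fun t t' ht =>
    fdist_blockPoint_eq_zero hℓ hab hagree _ _ _ _ ht
  have hF' : ∀ t t', ∀ s > 0, FdistStar d (genShift φ) (x t) (x t') s = 1 := fun t t' s hs =>
    fdistStar_blockPoint_eq_one hd hℓ a b hs _ _ _ _ _ _
  have hinj : Function.Injective x := fun t t' heq => by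
    by_contra ht
    have h0 := hF t t' ht
    rw [heq, fdist_self hd _ _ hε] at h0
    exact one_ne_zero h0
  have hpair : ∀ u ∈ Set.range x, ∀ v ∈ Set.range x, u ≠ v →
      Fdist d (genShift φ) u v ε = 0 := by
    rintro _ ⟨t, rfl⟩ _ ⟨t', rfl⟩ hne
    exact hF t t' fun e => hne (congrArg x e)
  refine ⟨Set.range x, ?_, ?_, ⟨?_, ?_⟩, ε, hε, hpair⟩
  · intro hcount
    have : Countable (Set.range x) := hcount
    have : Countable (Set ℕ) := (Set.rangeFactorization_injective.2 hinj).countable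
    obtain ⟨f, hf⟩ := exists_injective_nat (Set ℕ)
    exact Function.cantor_injective f hf
  · refine dense_iff_inter_open.2 fun U hU hne => ?_
    obtain ⟨z, hz⟩ := hne
    obtain ⟨I, u, hu, hsub⟩ := isOpen_pi_iff.1 hU z hz
    obtain ⟨_, hq, n, rfl⟩ := (TopologicalSpace.denseRange_denseSeq (Γ → X)).inter_open_nonempty
      ((I : Set Γ).pi u) (isOpen_set_pi I.finite_toSet fun i hi => (hu i hi).1)
      ⟨z, fun i hi => (hu i hi).2⟩
    obtain ⟨t, ht⟩ := hp (I, n)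
    refine ⟨x t, hsub fun i hi => ?_, t, rfl⟩
    have hi' : i ∈ (p t).1 := by rw [ht]; exact hi
    simp only [x, blockPoint, if_pos hi', ht]
    exact hq i hi
  · exact Set.nontrivial_of_mem_mem_ne (Set.mem_range_self ∅) (Set.mem_range_self Set.univ)
      (hinj.ne Set.empty_ne_univ)
  · intro u hu v hv hne
    refine ⟨⟨ε, hε, hpair u hu v hv hne⟩, ?_⟩
    obtain ⟨t, rfl⟩ := hu
    obtain ⟨t', rfl⟩ := hv
    exact hF' t t'

end Main

variable {X : Type*} [Fintype X] [TopologicalSpace X] [DiscreteTopology X] [Nontrivial X]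
variable {Γ : Type*} [Countable Γ] [Nonempty Γ]
/-- for any compatible metric `d` on `X^Γ`, `(X^Γ, σ_φ)` is dense
distributionally chaotic iff `φ` has no periodic point. -/
theorem denseDC_iff_no_periodicPt
    (φ : Γ → Γ)
    (d : (Γ → X) → (Γ → X) → ℝ) (hd : IsCompatibleMetric (Γ → X) d) :
    DenseDC d (genShift (X := X) φ) ↔ ∀ θ : Γ, ¬ PeriodicPt φ θ := by
  exact ⟨not_periodicPt_of_denseDC hd, denseDC_of_no_periodicPt hd⟩
end
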